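/- The group presented on two generators t, x with defining relations t^4 = 1, x^3 = 1, (t^2 * x)^2 = 1, (t * x)^9 = 1, and (t⁻¹ * x⁻¹ * t * x)^9 = 1 is the trivial group (has cardinality 1). -/

import Mathlib

/-- The relations `t⁴, x³, (t²x)², (tx)⁹, [t,x]⁹` on generators `t = of 0`, `x = of 1`. -/
def rels16 : Set (FreeGroup (Fin 2)) :=
  { (FreeGroup.of 0) ^ 4, (FreeGroup.of 1) ^ 3,
    ((FreeGroup.of 0) ^ 2 * FreeGroup.of 1) ^ 2,
    (FreeGroup.of 0 * FreeGroup.of 1) ^ 9,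
    ((FreeGroup.of 0)⁻¹ * (FreeGroup.of 1)⁻¹ * FreeGroup.of 0 * FreeGroup.of 1) ^ 9 }

/-! The proof is a pruned Todd–Coxeter coset enumeration over the subgroup generated by `t * x`,
replayed by a verified checker. Letters: `0 = t`, `1 = t⁻¹`, `2 = x`, `3 = x⁻¹`. A coset is coded
by a natural number: `0` is the subgroup, and `4 * m + g + 1` is coset `m` times the letter `g`. -/

namespace CosetEnum

/-- Steps of the enumeration: definition of a coset, deduction from a relator, coincidence. -/
inductive Step where
  | d (m g : ℕ)
  | r (i a k b : ℕ)
  | c (i g j k : ℕ)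

/-- A table entry `(i, g, j)`: coset `i` times letter `g` is coset `j`. -/
abbrev Fact := ℕ × ℕ × ℕ

/-- The inverse letter. -/
def invL : ℕ → ℕ
  | 0 => 1
  | 1 => 0
  | 2 => 3
  | _ => 2

/-- Look up an entry of the table. -/
def look : List Fact → ℕ → ℕ → Option ℕ
  | [], _, _ => none
  | (i, g, j) :: F, a, h => bif Nat.beq i a && Nat.beq g h then some j else look F a h

/-- Trace a word through the table. -/
def trace (F : List Fact) : List ℕ → ℕ → Option ℕ
  | [], a => some a
  | g :: w, a => match look F a g with
    | none => none
    | some b => trace F w b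

/-- Membership test. -/
def mem : List Fact → ℕ → ℕ → ℕ → Bool
  | [], _, _, _ => false
  | (i, g, j) :: F, a, h, b => (Nat.beq i a && Nat.beq g h && Nat.beq j b) || mem F a h b

/-- Repeat a word. -/
def rep (w : List ℕ) : ℕ → List ℕ
  | 0 => []
  | n + 1 => w ++ rep w n

/-- The relators, and the subgroup generator (only valid at coset `0`). -/
def relator : ℕ → List ℕ
  | 0 => rep [0] 4
  | 1 => rep [2] 3
  | 2 => rep [0, 0, 2] 2
  | 3 => rep [0, 2] 9
  | 4 => rep [1, 3, 0, 2] 9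
  | _ => [0, 2]

/-- Replace `k` by `j`. -/
def sub (j k n : ℕ) : ℕ := bif Nat.beq n k then j else n

/-- One step of the checker. -/
def step (F : List Fact) : Step → Option (List Fact)
  | .d m g => bif Nat.ble g 3 then
      some ((m, g, 4 * m + g + 1) :: (4 * m + g + 1, invL g, m) :: F) else none
  | .r i a k b =>
    bif Nat.ble i 4 || Nat.beq a 0 then
      match trace F ((relator i).take k) a, (relator i).drop k with
      | some f, g :: w => match trace F w b with
        | some a' => bif Nat.beq a' a && Nat.ble g 3 then
            some ((f, g, b) :: (b, invL g, f) :: F) else none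
        | none => none
      | _, _ => none
    else none
  | .c i g j k => bif mem F i g j && mem F i g k then
      some (F.map fun e => (sub j k e.1, e.2.1, sub j k e.2.2)) else none

/-- Run the checker. -/
def run : List Step → List Fact → Option (List Fact)
  | [], F => some F
  | s :: L, F => match step F s with
    | some F' => run L F'
    | none => none

/-- The final test: the subgroup is fixed by `t`. -/
def check (L : List Step) : Bool := match run L [] with
  | some F => mem F 0 0 0
  | none => false

/-- The enumeration. -/
def cert : List Step := [
    .d 0 0, .r 5 0 1 0, .d 0 1, .d 0 2, .r 1 0 1 1, .d 1 0, .r 0 1 1 2, .r 2 0 2 2, .d 2 2,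
    .r 1 2 1 5, .d 3 0, .r 2 3 1 11, .d 3 1, .r 0 14 3 14, .d 13 2, .d 13 3, .r 1 56 2 56,
    .d 14 2, .d 14 3, .r 1 60 2 60, .d 55 0, .r 2 55 1 60, .d 55 1, .r 0 222 3 222, .d 56 0,
    .r 2 56 1 59, .d 56 1, .r 0 226 3 226, .d 221 2, .d 221 3, .r 1 888 2 888, .d 222 2, .d 222 3,
    .r 1 892 2 892, .d 225 2, .d 225 3, .r 1 904 2 904, .d 226 2, .d 226 3, .r 1 908 2 908,
    .d 887 0, .r 2 887 1 892, .d 887 1, .r 0 3550 3 3550, .d 888 0, .r 2 888 1 891, .d 888 1,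
    .r 0 3554 3 3554, .d 903 0, .r 2 903 1 908, .d 903 1, .r 0 3614 3 3614, .d 904 0,
    .r 2 904 1 907, .d 904 1, .r 0 3618 3 3618, .d 3549 2, .d 3549 3, .r 1 14200 2 14200,
    .d 3550 3, .d 3553 2, .d 3553 3, .r 1 14216 2 14216, .d 3554 2, .d 3554 3, .r 1 14220 2 14220,
    .r 3 14199 0 14220, .r 2 14199 1 14204, .r 2 14215 0 14199, .r 0 14215 3 14215, .d 3613 2,
    .d 3613 3, .r 1 14456 2 14456, .d 3614 2, .d 3614 3, .r 1 14460 2 14460, .d 3617 2, .d 3617 3,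
    .r 1 14472 2 14472, .d 3618 2, .d 3618 3, .r 1 14476 2 14476, .d 14200 0, .d 14200 1,
    .d 14216 0, .r 2 14216 1 14219, .d 14216 1, .r 0 56866 3 56866, .d 14455 0,
    .r 2 14455 1 14460, .d 14455 1, .r 0 57822 3 57822, .d 14456 0, .r 2 14456 1 14459,
    .d 14456 1, .r 0 57826 3 57826, .d 14471 0, .r 2 14471 1 14476, .d 14471 1,
    .r 0 57886 3 57886, .d 14472 0, .r 2 14472 1 14475, .d 14472 1, .r 0 57890 3 57890,
    .r 3 14475 1 57826, .r 2 57889 5 57889, .d 56801 2, .d 56802 3, .d 56865 2, .d 56865 3,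
    .r 1 227464 2 227464, .d 56866 2, .d 56866 3, .r 1 227468 2 227468, .d 57821 2, .d 57822 3,
    .d 57825 3, .r 1 231304 2 231304, .d 57826 2, .r 1 57826 1 57890, .d 57885 3, .d 227207 0,
    .r 2 227207 1 227212, .d 227463 0, .r 2 227463 1 227468, .d 227463 1, .r 0 909854 3 909854,
    .d 227464 0, .r 2 227464 1 227467, .d 227464 1, .r 0 909858 3 909858, .d 231287 0,
    .r 2 231287 1 231292, .d 231304 0, .r 2 231304 1 231307, .d 231304 1, .r 0 925218 3 925218,
    .d 231544 0, .d 231544 1, .d 908829 2, .d 908829 3, .r 1 3635320 2 3635320, .d 909857 2,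
    .d 909857 3, .r 1 3639432 2 3639432, .d 909858 2, .d 909858 3, .r 3 3635319 0 3639436,
    .r 2 3639431 0 3635319, .d 925149 2, .r 3 231287 2 3635320, .d 925217 2, .d 925217 3,
    .r 1 3700872 2 3700872, .d 925218 2, .d 925218 3, .r 1 3700876 2 3700876, .d 926177 2,
    .d 926178 3, .r 3 3639435 0 3704716, .r 2 3639435 1 3639432, .r 2 3704711 0 3639435,
    .r 0 3704711 3 3704711, .d 3700871 0, .r 2 3700871 1 3700876, .d 3700871 1,
    .r 0 14803486 3 14803486, .d 3700872 0, .r 2 3700872 1 3700875, .d 3700872 1,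
    .r 0 14803490 3 14803490, .d 14803489 2, .d 14803489 3, .r 1 59213960 2 59213960,
    .d 14803490 2, .d 14803490 3, .r 1 59213964 2 59213964, .r 3 59213963 0 59213964,
    .r 2 59213963 1 59213960, .r 2 59213959 0 59213963, .r 0 59213959 3 59213959,
    .r 4 59213964 1 59213959, .c 59213963 3 14803490 59213959, .c 14803490 2 59213960 59213963,
    .c 14803490 3 14803489 59213964, .c 14803489 1 3700872 59213960, .c 3700872 2 925217 14803489,
    .c 925217 1 231304 3700872, .c 231304 2 57825 925217, .c 57825 1 14456 231304,
    .c 14456 2 3613 57825, .c 3613 1 903 14456, .c 903 2 904 3613, .c 904 0 908 3617,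
    .c 908 0 907 3614, .c 904 1 903 3618, .c 904 2 225 14455, .c 907 2 908 14459,
    .c 907 3 226 14460, .c 908 2 226 14471, .c 908 3 907 14472, .c 903 2 904 14475,
    .c 903 3 225 14476, .c 225 0 59 57821, .c 225 1 56 57822, .c 903 1 907 57826,
    .c 226 0 56 57885, .c 226 1 59 57886, .c 907 0 903 57889, .c 907 1 908 57890,
    .c 908 2 226 907, .c 226 3 226 908, .c 226 1 59 904, .c 59 2 60 225, .c 60 1 56 221,
    .c 60 0 59 222, .c 56 1 55 226, .c 56 2 13 887, .c 56 3 55 888, .c 59 2 60 891,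
    .c 59 3 14 892, .c 60 2 14 903, .c 55 2 55 56, .c 55 2 13 55, .c 13 0 11 13, .c 11 1 3 11,
    .c 3 3 0 2, .c 0 0 0 1, .c 0 2 0 3, .c 0 0 0 5, .c 0 1 0 14, .c 0 2 0 59, .c 0 3 0 60,
    .c 0 0 0 3549, .c 0 1 0 3550, .c 0 0 0 3553, .c 0 1 0 3554, .c 0 2 0 14199, .c 0 3 0 14200,
    .c 0 3 0 14204, .c 0 2 0 14215, .c 0 3 0 14216, .c 0 2 0 14219, .c 0 3 0 14220,
    .c 0 0 0 56801, .c 0 1 0 56802, .c 0 0 0 56865, .c 0 1 0 56866, .c 0 2 0 227207,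
    .c 0 3 0 227212, .c 0 2 0 227463, .c 0 3 0 227464, .c 0 2 0 227467, .c 0 3 0 227468,
    .c 0 2 0 231287, .c 0 3 0 231292, .c 0 2 0 231307, .c 0 3 0 231544, .c 0 0 0 908829,
    .c 0 0 0 909853, .c 0 1 0 909854, .c 0 0 0 909857, .c 0 1 0 909858, .c 0 0 0 925149,
    .c 0 1 0 925218, .c 0 0 0 926177, .c 0 1 0 926178, .c 0 2 0 3635319, .c 0 3 0 3635320,
    .c 0 2 0 3639431, .c 0 3 0 3639432, .c 0 2 0 3639435, .c 0 3 0 3639436, .c 0 2 0 3700599,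
    .c 0 2 0 3700871, .c 0 2 0 3700875, .c 0 3 0 3700876, .c 0 2 0 3704711, .c 0 3 0 3704716,
    .c 0 0 0 14803485, .c 0 1 0 14803486, .c 0 1 0 14803490]

theorem check_cert : check cert = true := by decide +kernel

section sound

variable {G : Type*} [Group G] {Q : Type*} [MulAction G Q]

/-- Letters act on (left) cosets through the inverses. -/
def ltr (t x : G) : ℕ → G
  | 0 => t⁻¹
  | 1 => t
  | 2 => x⁻¹
  | _ => x

theorem ltr_inv (t x : G) (g : ℕ) (h : g ≤ 3) : ltr t x (invL g) = (ltr t x g)⁻¹ := by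
  interval_cases g <;> simp [ltr, invL]

/-- Action of a word. -/
def app (t x : G) : List ℕ → Q → Q
  | [], q => q
  | g :: w, q => app t x w (ltr t x g • q)

theorem app_append (t x : G) (u w : List ℕ) (q : Q) :
    app t x (u ++ w) q = app t x w (app t x u q) := by
  induction u generalizing q with
  | nil => rfl
  | cons g u ih => exact ih _

theorem app_inj (t x : G) (w : List ℕ) (q q' : Q) (h : app t x w q = app t x w q') : q = q' := by
  induction w generalizing q q' with
  | nil => exact h
  | cons g w ih => exact MulAction.injective _ (ih _ _ h)

/-- The meaning of a table. -/
def Ok (t x : G) (v : ℕ → Q) (F : List Fact) : Prop :=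
  ∀ i g j, (i, g, j) ∈ F → ltr t x g • v i = v j

theorem look_mem (F : List Fact) (a h b : ℕ) (e : look F a h = some b) : (a, h, b) ∈ F := by
  induction F with
  | nil => simp [look] at e
  | cons f F ih =>
    obtain ⟨i, g, j⟩ := f
    rw [look] at e
    cases hc : (Nat.beq i a && Nat.beq g h) with
    | false =>
      rw [hc] at e
      exact List.mem_cons_of_mem _ (ih e)
    | true =>
      rw [hc] at e
      simp at hc e
      obtain ⟨rfl, rfl⟩ := hc
      subst e
      simp

theorem mem_mem (F : List Fact) (a h b : ℕ) (e : mem F a h b = true) : (a, h, b) ∈ F := by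
  induction F with
  | nil => simp [mem] at e
  | cons f F ih =>
    obtain ⟨i, g, j⟩ := f
    simp only [mem, Bool.or_eq_true, Bool.and_eq_true, Nat.beq_eq] at e
    rcases e with ⟨⟨rfl, rfl⟩, rfl⟩ | e
    · simp
    · exact List.mem_cons_of_mem _ (ih e)

theorem trace_ok (t x : G) (v : ℕ → Q) (F : List Fact) (hF : Ok t x v F) (w : List ℕ) (a b : ℕ)
    (e : trace F w a = some b) : app t x w (v a) = v b := by
  induction w generalizing a with
  | nil =>
    simp [trace] at e
    simp [app, e]
  | cons g w ih =>
    rw [trace] at e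
    cases hl : look F a g with
    | none => simp [hl] at e
    | some c =>
      rw [hl] at e
      rw [app, hF _ _ _ (look_mem _ _ _ _ hl)]
      exact ih _ e

theorem ok_cons (t x : G) (v : ℕ → Q) (F : List Fact) (hF : Ok t x v F) (i g j : ℕ) (hg : g ≤ 3)
    (h : ltr t x g • v i = v j) : Ok t x v ((i, g, j) :: (j, invL g, i) :: F) := by
  intro i' g' j' hm
  simp only [List.mem_cons, Prod.mk.injEq] at hm
  rcases hm with ⟨rfl, rfl, rfl⟩ | ⟨rfl, rfl, rfl⟩ | hm
  · exact h
  · rw [ltr_inv _ _ _ hg, ← h, inv_smul_smul]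
  · exact hF _ _ _ hm

theorem sub_ok (v : ℕ → Q) (j k n : ℕ) (h : v j = v k) : v (sub j k n) = v n := by
  unfold sub
  cases hc : Nat.beq n k with
  | false => rfl
  | true =>
    rw [Nat.beq_eq] at hc
    simp [hc, h]

theorem step_ok (t x : G) (v : ℕ → Q)
    (hv : ∀ m g, g ≤ 3 → v (4 * m + g + 1) = ltr t x g • v m)
    (hr : ∀ i, i ≤ 4 → ∀ q : Q, app t x (relator i) q = q)
    (h0 : ∀ i, app t x (relator i) (v 0) = v 0)
    (F F' : List Fact) (s : Step) (hF : Ok t x v F) (e : step F s = some F') : Ok t x v F' := by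
  cases s with
  | d m g =>
    simp only [step] at e
    cases hc : Nat.ble g 3 with
    | false => simp [hc] at e
    | true =>
      simp only [hc, cond_true, Option.some.injEq] at e
      rw [Nat.ble_eq] at hc
      subst e
      exact ok_cons _ _ _ _ hF _ _ _ hc (hv m g hc).symm
  | r i a k b =>
    simp only [step] at e
    cases hc : (Nat.ble i 4 || Nat.beq a 0) with
    | false => simp [hc] at e
    | true =>
      have hrel : app t x (relator i) (v a) = v a := by
        simp only [Bool.or_eq_true, Nat.ble_eq, Nat.beq_eq] at hc
        rcases hc with hc | rfl
        · exact hr i hc _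
        · exact h0 i
      simp only [hc, cond_true] at e
      split at e
      · rename_i f g w hf hw
        split at e
        · rename_i a' ha'
          cases hd : (Nat.beq a' a && Nat.ble g 3) with
          | false => simp [hd] at e
          | true =>
            simp only [hd, cond_true, Option.some.injEq] at e
            simp only [Bool.and_eq_true, Nat.ble_eq, Nat.beq_eq] at hd
            obtain ⟨rfl, hg⟩ := hd
            subst e
            refine ok_cons _ _ _ _ hF _ _ _ hg (app_inj t x w _ _ ?_)
            rw [trace_ok t x v F hF _ _ _ ha', ← trace_ok t x v F hF _ _ _ hf]
            rw [← List.take_append_drop k (relator i), app_append, hw] at hrel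
            exact hrel
        · simp at e
      · simp at e
  | c i g j k =>
    simp only [step] at e
    cases hc : (mem F i g j && mem F i g k) with
    | false => simp [hc] at e
    | true =>
      simp only [hc, cond_true, Option.some.injEq] at e
      simp only [Bool.and_eq_true] at hc
      have hjk : v j = v k := by
        rw [← hF _ _ _ (mem_mem _ _ _ _ hc.1), ← hF _ _ _ (mem_mem _ _ _ _ hc.2)]
      subst e
      intro a h b hm
      simp only [List.mem_map, Prod.mk.injEq] at hm
      obtain ⟨⟨a', h', b'⟩, hm, rfl, rfl, rfl⟩ := hm
      rw [sub_ok v _ _ _ hjk, sub_ok v _ _ _ hjk]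
      exact hF _ _ _ hm

theorem run_ok (t x : G) (v : ℕ → Q)
    (hv : ∀ m g, g ≤ 3 → v (4 * m + g + 1) = ltr t x g • v m)
    (hr : ∀ i, i ≤ 4 → ∀ q : Q, app t x (relator i) q = q)
    (h0 : ∀ i, app t x (relator i) (v 0) = v 0)
    (L : List Step) (F F' : List Fact) (hF : Ok t x v F) (e : run L F = some F') :
    Ok t x v F' := by
  induction L generalizing F with
  | nil =>
    simp only [run, Option.some.injEq] at e
    exact e ▸ hF
  | cons s L ih =>
    rw [run] at e
    cases hs : step F s with
    | none => simp [hs] at e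
    | some F1 =>
      rw [hs] at e
      exact ih F1 (step_ok t x v hv hr h0 F F1 s hF hs) e

/-- The coset with a given code. -/
def code (t x : G) (q : Q) : ℕ → Q
  | 0 => q
  | n + 1 => ltr t x (n % 4) • code t x q (n / 4)
decreasing_by omega

theorem app_rep (t x : G) (w : List ℕ) (c : G) (hc : ∀ q : Q, app t x w q = c⁻¹ • q) (n : ℕ)
    (q : Q) : app t x (rep w n) q = (c ^ n)⁻¹ • q := by
  induction n generalizing q with
  | zero => simp [rep, app]
  | succ n ih => rw [rep, app_append, hc, ih, smul_smul, pow_succ', mul_inv_rev]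

theorem fixes (t x : G) (h1 : t ^ 4 = 1) (h2 : x ^ 3 = 1) (h3 : (t ^ 2 * x) ^ 2 = 1)
    (h4 : (t * x) ^ 9 = 1) (h5 : (t⁻¹ * x⁻¹ * t * x) ^ 9 = 1) (b : Q) (hb : (t * x) • b = b) :
    t • b = b := by
  have hr : ∀ i, i ≤ 4 → ∀ q : Q, app t x (relator i) q = q := by
    intro i hi q
    interval_cases i
    · rw [relator, app_rep t x _ t (fun q => by simp [app, ltr]), h1]; simp
    · rw [relator, app_rep t x _ x (fun q => by simp [app, ltr]), h2]; simp
    · rw [relator, app_rep t x _ (t ^ 2 * x) (fun q => by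
        simp [app, ltr, smul_smul, pow_two, mul_assoc]), h3]; simp
    · rw [relator, app_rep t x _ (t * x) (fun q => by
        simp [app, ltr, smul_smul]), h4]; simp
    · rw [relator, app_rep t x _ (t⁻¹ * x⁻¹ * t * x) (fun q => by
        simp [app, ltr, smul_smul, mul_assoc]), h5]; simp
  have hz : code t x b 0 = b := by rw [code]
  have h0 : ∀ i, app t x (relator i) (code t x b 0) = code t x b 0 := by
    intro i
    by_cases hi : i ≤ 4
    · exact hr i hi _
    · obtain ⟨k, rfl⟩ : ∃ k, i = k + 5 := ⟨i - 5, by omega⟩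
      rw [hz]
      have : app t x (relator (k + 5)) b = (t * x)⁻¹ • b := by
        simp [relator, app, ltr, smul_smul]
      rw [this, inv_smul_eq_iff, hb]
  have hv : ∀ m g, g ≤ 3 → code t x b (4 * m + g + 1) = ltr t x g • code t x b m := by
    intro m g hg
    rw [code, show (4 * m + g) % 4 = g by omega, show (4 * m + g) / 4 = m by omega]
  have hc := check_cert
  unfold check at hc
  split at hc
  · rename_i F hF
    have := run_ok t x (code t x b) hv hr h0 cert [] F (by intro i g j h; simp at h) hF
      0 0 0 (mem_mem _ _ _ _ hc)
    rw [hz] at this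
    simp only [ltr] at this
    rw [inv_smul_eq_iff] at this
    exact this.symm
  · simp at hc

theorem trivial_of_rels (t x : G) (h1 : t ^ 4 = 1) (h2 : x ^ 3 = 1) (h3 : (t ^ 2 * x) ^ 2 = 1)
    (h4 : (t * x) ^ 9 = 1) (h5 : (t⁻¹ * x⁻¹ * t * x) ^ 9 = 1) : t = 1 ∧ x = 1 := by
  have hm : t ∈ Subgroup.zpowers (t * x) := by
    have hb : (t * x) • ((1 : G) : G ⧸ Subgroup.zpowers (t * x)) = ((1 : G) : G ⧸ _) := by
      rw [MulAction.Quotient.smul_coe, QuotientGroup.eq, smul_eq_mul, mul_one,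
        mul_one]
      exact inv_mem (Subgroup.mem_zpowers _)
    have := fixes t x h1 h2 h3 h4 h5 _ hb
    rw [MulAction.Quotient.smul_coe, QuotientGroup.eq] at this
    simpa using this
  obtain ⟨n, hn⟩ := Subgroup.mem_zpowers_iff.1 hm
  have hct : Commute t (t * x) := by
    have := (Commute.refl (t * x)).zpow_left n
    rwa [hn] at this
  have hcx : Commute t x := by
    have : t * (t * x) = t * (x * t) := by rw [hct.eq, mul_assoc]
    exact mul_left_cancel this
  have hx2 : x ^ 2 = 1 := by
    rw [(hcx.pow_left 2).mul_pow, ← pow_mul, h1, one_mul] at h3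
    exact h3
  have hx : x = 1 := by
    rw [pow_succ, hx2, one_mul] at h2
    exact h2
  have ht : t = 1 := by
    rw [hx, mul_one, show 9 = 4 * 2 + 1 from rfl, pow_succ, pow_mul, h1, one_pow, one_mul] at h4
    exact h4
  exact ⟨ht, hx⟩

end sound

end CosetEnum

theorem CosetEnum.hom_trivial {P : Type*} [Group P] (φ : FreeGroup (Fin 2) →* P)
    (hrel : ∀ r ∈ rels16, φ r = 1) (a : FreeGroup (Fin 2)) : φ a = 1 := by
  have e1 := hrel ((FreeGroup.of 0) ^ 4) (by simp [rels16])
  have e2 := hrel ((FreeGroup.of 1) ^ 3) (by simp [rels16])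
  have e3 := hrel (((FreeGroup.of 0) ^ 2 * FreeGroup.of 1) ^ 2) (by simp [rels16])
  have e4 := hrel ((FreeGroup.of 0 * FreeGroup.of 1) ^ 9) (by simp [rels16])
  have e5 := hrel (((FreeGroup.of 0)⁻¹ * (FreeGroup.of 1)⁻¹ * FreeGroup.of 0 * FreeGroup.of 1) ^ 9)
    (by simp [rels16])
  simp only [map_pow, map_mul, map_inv] at e1 e2 e3 e4 e5
  have key := CosetEnum.trivial_of_rels _ _ e1 e2 e3 e4 e5
  have hhom : φ = 1 := by
    apply FreeGroup.ext_hom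
    intro a
    fin_cases a
    · exact key.1
    · exact key.2
  rw [hhom]
  rfl

/-- The group `⟨t, x ∣ t⁴, x³, (t²x)², (tx)⁹, [t,x]⁹⟩` is trivial. -/
theorem statement_16 : Nat.card (PresentedGroup rels16) = 1 := by
  have h := CosetEnum.hom_trivial (PresentedGroup.mk rels16)
    (fun r hr => PresentedGroup.one_of_mem hr)
  rw [Nat.card_eq_one_iff_unique]
  refine ⟨⟨fun a b => ?_⟩, ⟨1⟩⟩
  obtain ⟨a, rfl⟩ := PresentedGroup.mk_surjective rels16 a
  obtain ⟨b, rfl⟩ := PresentedGroup.mk_surjective rels16 b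
  exact (h a).trans (h b).symm
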